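/- Assume β i j ≥ 0 for all i, j and α j > 0 for all j. Let x ∈ ℝ^n satisfy ∑_{i=1}^n β i j · |x_i| < 1 for every j ∈ Fin m. For a finitely supported function I : Fin n → ℕ define p̃_ms(I) := ∫_{(0,∞)^m} (∏_{j=1}^m θ_j^{α_j − 1} e^{−θ_j} / Γ(α_j)) · ∏_{i=1}^n (∑_{j=1}^m β i j · θ_j)^{I(i)} dθ, x^I := ∏_i x_i^{I(i)} and I! := ∏_i I(i)!. Then the family I ↦ p̃_ms(I) · x^I / I!, indexed by all finitely supported I : Fin n → ℕ, is summable, and its sum equals ∏_{j=1}^m (1 − ∑_{i=1}^n β i j · x_i)^{−α_j}. -/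

import Mathlib

open MeasureTheory Real Finset

/-- The unnormalized probability of a multiset of observations, where the
multiplicity of observation `i` is `I i`. -/
noncomputable def ptildeMs (n m : ℕ) (α : Fin m → ℝ) (β : Fin n → Fin m → ℝ)
    (I : Fin n → ℕ) : ℝ :=
  ∫ θ : Fin m → ℝ in {θ | ∀ j, 0 < θ j},
    (∏ j, θ j ^ (α j - 1) * Real.exp (-θ j) / Real.Gamma (α j)) *
      ∏ i, (∑ j, β i j * θ j) ^ I i

lemma aux_mul {ι κ : Type*} (f : ι → ℝ) (g : κ → ℝ) (a b : ℝ) (h1 : HasSum f a)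
    (h2 : HasSum g b) : HasSum (fun p : ι × κ => f p.1 * g p.2) (a * b) :=
  h1.mul h2 (summable_mul_of_summable_norm h1.summable.norm h2.summable.norm)

lemma aux_hasSum (n : ℕ) : ∀ (y : Fin n → ℝ),
    HasSum (fun I : Fin n → ℕ => ∏ i, y i ^ I i / ((I i).factorial : ℝ))
      (Real.exp (∑ i, y i)) := by
  induction n with
  | zero =>
    intro y
    simp
  | succ n ih =>
    intro y
    have h1 : HasSum (fun k : ℕ => y 0 ^ k / (k.factorial : ℝ)) (Real.exp (y 0)) := by
      rw [Real.exp_eq_exp_ℝ]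
      exact NormedSpace.expSeries_div_hasSum_exp (y 0)
    have h2 := ih (fun i => y i.succ)
    have h3 := aux_mul _ _ _ _ h1 h2
    rw [Fin.sum_univ_succ, Real.exp_add]
    rw [← (Fin.consEquiv (fun _ : Fin (n + 1) => ℕ)).hasSum_iff]
    have h4 : ((fun I : Fin (n + 1) → ℕ => ∏ i, y i ^ I i / ((I i).factorial : ℝ)) ∘
        (Fin.consEquiv (fun _ : Fin (n + 1) => ℕ))) = fun p : ℕ × (Fin n → ℕ) =>
        (y 0 ^ p.1 / (p.1.factorial : ℝ)) *
          ∏ i, y (Fin.succ i) ^ p.2 i / ((p.2 i).factorial : ℝ) := by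
      funext p
      simp only [Function.comp_apply, Fin.consEquiv, Equiv.coe_fn_mk, Fin.prod_univ_succ,
        Fin.cons_zero, Fin.cons_succ]
    rw [h4]
    exact h3

lemma aux_restrict (m : ℕ) :
    (volume : Measure (Fin m → ℝ)).restrict {θ | ∀ j, 0 < θ j} =
      Measure.pi (fun _ : Fin m => (volume : Measure ℝ).restrict (Set.Ioi 0)) := by
  rw [← Measure.restrict_pi_pi, volume_pi]
  congr 1
  ext θ
  simp

lemma aux_eq (n m : ℕ) (α : Fin m → ℝ) (β : Fin n → Fin m → ℝ) (y : Fin n → ℝ)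
    (θ : Fin m → ℝ) :
    (∏ j, θ j ^ (α j - 1) * Real.exp (-θ j) / Real.Gamma (α j)) *
      Real.exp (∑ i, (∑ j, β i j * θ j) * y i) =
    ∏ j, (θ j ^ (α j - 1) * Real.exp (-((1 - ∑ i, β i j * y i) * θ j))) / Real.Gamma (α j) := by
  have : ∑ i, (∑ j, β i j * θ j) * y i = ∑ j, (∑ i, β i j * y i) * θ j := by
    simp_rw [Finset.sum_mul]
    rw [Finset.sum_comm]
    refine Finset.sum_congr rfl fun j _ => Finset.sum_congr rfl fun i _ => by ring
  rw [this, Real.exp_sum, ← Finset.prod_mul_distrib]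
  refine Finset.prod_congr rfl fun j _ => ?_
  rw [show -((1 - ∑ i, β i j * y i) * θ j) = -θ j + (∑ i, β i j * y i) * θ j by ring,
    Real.exp_add]
  ring

lemma aux_integrable (n m : ℕ) (α : Fin m → ℝ) (hα : ∀ j, 0 < α j)
    (β : Fin n → Fin m → ℝ) (y : Fin n → ℝ) (hy : ∀ j, ∑ i, β i j * y i < 1) :
    Integrable (fun θ : Fin m → ℝ =>
      (∏ j, θ j ^ (α j - 1) * Real.exp (-θ j) / Real.Gamma (α j)) *
      Real.exp (∑ i, (∑ j, β i j * θ j) * y i))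
      (volume.restrict {θ | ∀ j, 0 < θ j}) := by
  simp_rw [aux_eq]
  rw [aux_restrict]
  refine Integrable.fintype_prod (f := fun j t => (t ^ (α j - 1) *
    Real.exp (-((1 - ∑ i, β i j * y i) * t))) / Real.Gamma (α j)) fun j => ?_
  refine Integrable.div_const ?_ _
  have h : 0 < 1 - ∑ i, β i j * y i := sub_pos.2 (hy j)
  refine .of_integral_ne_zero ?_
  rw [integral_rpow_mul_exp_neg_mul_Ioi (hα j) h]
  have := Real.Gamma_pos_of_pos (hα j)
  positivity

lemma aux_integral (n m : ℕ) (α : Fin m → ℝ) (hα : ∀ j, 0 < α j)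
    (β : Fin n → Fin m → ℝ) (y : Fin n → ℝ) (hy : ∀ j, ∑ i, β i j * y i < 1) :
    ∫ θ : Fin m → ℝ in {θ | ∀ j, 0 < θ j},
      (∏ j, θ j ^ (α j - 1) * Real.exp (-θ j) / Real.Gamma (α j)) *
      Real.exp (∑ i, (∑ j, β i j * θ j) * y i) =
    ∏ j, (1 - ∑ i, β i j * y i) ^ (-(α j)) := by
  simp_rw [aux_eq]
  rw [aux_restrict]
  rw [integral_fintype_prod_eq_prod (fun j t => (t ^ (α j - 1) *
    Real.exp (-((1 - ∑ i, β i j * y i) * t))) / Real.Gamma (α j))]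
  refine Finset.prod_congr rfl fun j _ => ?_
  have h : 0 < 1 - ∑ i, β i j * y i := sub_pos.2 (hy j)
  rw [integral_div, integral_rpow_mul_exp_neg_mul_Ioi (hα j) h,
    mul_div_assoc, div_self (Real.Gamma_pos_of_pos (hα j)).ne', mul_one, one_div,
    Real.inv_rpow h.le, Real.rpow_neg h.le]

theorem generating_function (n m : ℕ) (hn : 1 ≤ n) (hm : 1 ≤ m)
    (α : Fin m → ℝ) (hα : ∀ j, 0 < α j)
    (β : Fin n → Fin m → ℝ) (hβ : ∀ i j, 0 ≤ β i j)
    (x : Fin n → ℝ) (hx : ∀ j, ∑ i, β i j * |x i| < 1) :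
    HasSum
      (fun I : Fin n → ℕ =>
        ptildeMs n m α β I * (∏ i, x i ^ I i) / ∏ i, ((I i).factorial : ℝ))
      (∏ j, (1 - ∑ i, β i j * x i) ^ (-(α j))) := by
  have hx' : ∀ j, ∑ i, β i j * x i < 1 := fun j =>
    (Finset.sum_le_sum fun i _ => mul_le_mul_of_nonneg_left (le_abs_self _) (hβ i j)).trans_lt
      (hx j)
  rw [← aux_integral n m α hα β x hx']
  have hms : MeasurableSet {θ : Fin m → ℝ | ∀ j, 0 < θ j} := by
    simp only [Set.ofPred_forall]
    exact MeasurableSet.iInter fun j => measurableSet_lt measurable_const (measurable_pi_apply j)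
  have hS : ∀ y : Fin n → ℝ, ∀ θ : Fin m → ℝ, HasSum (fun I : Fin n → ℕ =>
      (∏ j, θ j ^ (α j - 1) * Real.exp (-θ j) / Real.Gamma (α j)) *
        ∏ i, ((∑ j, β i j * θ j) * y i) ^ I i / ((I i).factorial : ℝ))
      ((∏ j, θ j ^ (α j - 1) * Real.exp (-θ j) / Real.Gamma (α j)) *
      Real.exp (∑ i, (∑ j, β i j * θ j) * y i)) := fun y θ =>
    (aux_hasSum n fun i => (∑ j, β i j * θ j) * y i).mul_left _
  have key := hasSum_integral_of_dominated_convergence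
    (μ := volume.restrict {θ : Fin m → ℝ | ∀ j, 0 < θ j})
    (F := fun (I : Fin n → ℕ) θ =>
      (∏ j, θ j ^ (α j - 1) * Real.exp (-θ j) / Real.Gamma (α j)) *
        ∏ i, ((∑ j, β i j * θ j) * x i) ^ I i / ((I i).factorial : ℝ))
    (f := fun θ => (∏ j, θ j ^ (α j - 1) * Real.exp (-θ j) / Real.Gamma (α j)) *
      Real.exp (∑ i, (∑ j, β i j * θ j) * x i))
    (fun (I : Fin n → ℕ) θ =>
      (∏ j, θ j ^ (α j - 1) * Real.exp (-θ j) / Real.Gamma (α j)) *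
        ∏ i, ((∑ j, β i j * θ j) * |x i|) ^ I i / ((I i).factorial : ℝ))
    ?_ ?_ ?_ ?_ ?_
  · refine key.congr_fun fun I => ?_
    rw [ptildeMs, mul_div_assoc, ← integral_mul_const]
    congr 1
    funext θ
    rw [mul_assoc]
    congr 1
    rw [← Finset.prod_div_distrib, ← Finset.prod_mul_distrib]
    refine Finset.prod_congr rfl fun i _ => ?_
    rw [mul_pow, mul_div_assoc]
  · intro I
    refine Measurable.aestronglyMeasurable ?_
    fun_prop
  · intro I
    refine (ae_restrict_iff' hms).2 (ae_of_all _ fun θ hθ => ?_)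
    have hθ' : ∀ j, 0 < θ j := hθ
    have hG := fun j => Real.Gamma_pos_of_pos (hα j)
    have h1 : 0 ≤ ∏ j, θ j ^ (α j - 1) * Real.exp (-θ j) / Real.Gamma (α j) :=
      Finset.prod_nonneg fun j _ => div_nonneg
        (mul_nonneg (Real.rpow_nonneg (hθ' j).le _) (Real.exp_pos _).le) (hG j).le
    rw [Real.norm_eq_abs, abs_mul, abs_of_nonneg h1, Finset.abs_prod]
    refine le_of_eq ?_
    congr 1
    refine Finset.prod_congr rfl fun i _ => ?_
    have h2 : 0 ≤ ∑ j, β i j * θ j :=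
      Finset.sum_nonneg fun j _ => mul_nonneg (hβ i j) (hθ' j).le
    rw [abs_div, abs_pow, abs_mul, abs_of_nonneg h2, Nat.abs_cast]
  · exact ae_of_all _ fun θ => (hS (fun i => |x i|) θ).summable
  · simp_rw [fun θ => (hS (fun i => |x i|) θ).tsum_eq]
    exact aux_integrable n m α hα β _ hx
  · exact ae_of_all _ fun θ => hS x θ
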